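/- arXiv:1809.07874 — 4 statements merged into one kernel-verified Lean document; each statement's English description precedes it below -/
import Mathlib

section
/- Let μ and ν be probability measures on a measurable space Ω with ν absolutely continuous with respect to μ and KL(ν‖μ) < ∞, and let f : Ω → ℝ be measurable with exp∘f integrable with respect to μ and f integrable with respect to ν. Then ∫ f dν ≤ log ∫ exp(f) dμ + KL(ν‖μ). -/
open MeasureTheory

/-- Kullback–Leibler divergence `KL(ν‖μ) := ∫ log(dν/dμ) dν` (as a real number). -/
noncomputable def klDiv {Ω : Type*} [MeasurableSpace Ω] (ν μ : Measure Ω) : ℝ :=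
  ∫ ω, Real.log ((ν.rnDeriv μ ω).toReal) ∂ν

/-- **Donsker–Varadhan change-of-measure inequality.**
If `ν ≪ μ` are probability measures with `KL(ν‖μ) < ∞` (expressed as integrability of
`log(dν/dμ)` with respect to `ν`), `exp ∘ f` is `μ`-integrable and `f` is `ν`-integrable, then
`∫ f dν ≤ log ∫ exp(f) dμ + KL(ν‖μ)`. -/
theorem stmt1 {Ω : Type*} [MeasurableSpace Ω] (μ ν : Measure Ω)
    [IsProbabilityMeasure μ] [IsProbabilityMeasure ν]
    (hac : ν ≪ μ)
    (hKLfin : Integrable (fun ω => Real.log ((ν.rnDeriv μ ω).toReal)) ν)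
    (f : Ω → ℝ) (hf : Measurable f)
    (hexp : Integrable (fun ω => Real.exp (f ω)) μ)
    (hfint : Integrable f ν) :
    ∫ ω, f ω ∂ν ≤ Real.log (∫ ω, Real.exp (f ω) ∂μ) + klDiv ν μ := by
  have : IsProbabilityMeasure (μ.tilted f) := isProbabilityMeasure_tilted hexp
  have hllr : Integrable (llr ν μ) ν := hKLfin
  have gibbs := InformationTheory.integral_llr_add_sub_measure_univ_nonneg
    (hac.trans (absolutelyContinuous_tilted hexp))
    (integrable_llr_tilted_right hac hfint hllr hexp)
  rw [integral_llr_tilted_right hac hfint hexp hllr] at gibbs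
  simp only [probReal_univ] at gibbs
  have hkl : klDiv ν μ = ∫ ω, llr ν μ ω ∂ν := rfl
  linarith
end

section
/- In the finite-MDP setting, fix t < T, fix x ∈ 𝒳 with p_t(x) > 0, and suppose q_t(x̃|x) > 0 and q̄_t(x̃) > 0 for all x̃. Treat the values {q_t(x̃|x)}_{x̃∈𝒳̃} as real variables in the Lagrangian L defined as in the finite-MDP Lagrangian (with the marginals q̄_t held fixed), and suppose there is a multiplier λ ∈ ℝ such that for every x̃ ∈ 𝒳̃ the partial derivative of L with respect to q_t(x̃|x) equals λ (stationarity under the normalization constraint Σ_{x̃} q_t(x̃|x) = 1). If additionally Σ_{x̃} q_t(x̃|x) = 1, then for every x̃: q_t(x̃|x) = q̄_t(x̃) exp( −β E(ν_{t+1} + c_t | x, x̃) ) / Z_t(x), where Z_t(x) := Σ_{x̃} q̄_t(x̃) exp( −β E(c_t + ν_{t+1} | x, x̃) ); i.e., the optimal encoder is a Boltzmann distribution with partition function Z_t(x). -/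
open Finset

/-- Conditional expectation `E(c + ν' | x, x̃) = ∑ u, π(u|x̃) (c(x,u) + ∑ x', p(x'|x,u) ν'(x'))`. -/
noncomputable def EcondXXt {X Xt U : Type*} [Fintype X] [Fintype U]
    (ptr : X → U → X → ℝ) (pol : Xt → U → ℝ) (c : X → U → ℝ) (ν' : X → ℝ)
    (x : X) (xt : Xt) : ℝ :=
  ∑ u, pol xt u * (c x u + ∑ x', ptr x u x' * ν' x')

/-- The finite-MDP Lagrangian `L = ∑_{t=0}^{T-1} L_t`, with the marginals `qbar` held fixed. -/
noncomputable def Lag {X Xt U : Type*} [Fintype X] [Fintype Xt] [Fintype U]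
    (T : ℕ) (β : ℝ)
    (ptr : ℕ → X → U → X → ℝ) (q : ℕ → X → Xt → ℝ) (pol : ℕ → Xt → U → ℝ)
    (c : ℕ → X → U → ℝ) (ν : ℕ → X → ℝ) (qbar : ℕ → Xt → ℝ)
    (pm : ℕ → X → ℝ) : ℝ :=
  ∑ t ∈ Finset.range T,
    ((∑ xt, ∑ u, ∑ x, c t x u * pol t xt u * q t x xt * pm t x)
      - (∑ x', ν (t + 1) x' *
          (pm (t + 1) x' - ∑ x, ∑ u, ∑ xt, ptr t x u x' * pol t xt u * q t x xt * pm t x))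
      + (1 / β) * ∑ x, ∑ xt, q t x xt * pm t x * Real.log (q t x xt / qbar t xt))

/-- The Lagrangian as a sum of terms each depending on a single encoder value. -/
theorem Lag_eq_sum {X Xt U : Type*} [Fintype X] [Fintype Xt] [Fintype U]
    (T : ℕ) (β : ℝ)
    (ptr : ℕ → X → U → X → ℝ) (q : ℕ → X → Xt → ℝ) (pol : ℕ → Xt → U → ℝ)
    (c : ℕ → X → U → ℝ) (ν : ℕ → X → ℝ) (qbar : ℕ → Xt → ℝ) (pm : ℕ → X → ℝ) :
    Lag T β ptr q pol c ν qbar pm =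
      (∑ t ∈ range T, ∑ x, ∑ xt, pm t x *
        (q t x xt * EcondXXt (ptr t) (pol t) (c t) (ν (t + 1)) x xt
          + (1 / β) * (q t x xt * Real.log (q t x xt / qbar t xt))))
      - ∑ t ∈ range T, ∑ x, ν (t + 1) x * pm (t + 1) x := by
  rw [Lag, ← sum_sub_distrib]
  refine sum_congr rfl fun t _ => ?_
  have hcost : ∑ xt, ∑ u, ∑ x, c t x u * pol t xt u * q t x xt * pm t x =
      ∑ x, ∑ xt, ∑ u, c t x u * pol t xt u * q t x xt * pm t x := by
    rw [sum_congr rfl fun xt _ => sum_comm, sum_comm]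
  have htrans : ∑ x', ν (t + 1) x' *
        ∑ x, ∑ u, ∑ xt, ptr t x u x' * pol t xt u * q t x xt * pm t x =
      ∑ x, ∑ xt, ∑ u, ∑ x', ν (t + 1) x' *
        (ptr t x u x' * pol t xt u * q t x xt * pm t x) := by
    simp only [mul_sum]
    rw [sum_comm]
    refine sum_congr rfl fun x _ => ?_
    rw [sum_comm, sum_congr rfl fun u _ => sum_comm, sum_comm]
  simp only [mul_sub, sum_sub_distrib]
  rw [hcost, htrans, sub_sub_eq_add_sub, sub_add_eq_add_sub]
  congr 1
  simp only [mul_sum, ← sum_add_distrib]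
  refine sum_congr rfl fun x _ => sum_congr rfl fun xt _ => ?_
  rw [EcondXXt, mul_add, mul_sum, mul_sum]
  congr 1
  · refine sum_congr rfl fun u _ => ?_
    rw [mul_add, mul_add, mul_add, mul_sum, mul_sum, mul_sum]
    congr 1
    · ring
    · exact sum_congr rfl fun x' _ => by ring
  · ring

/-- The partial derivative of the Lagrangian with respect to a positive encoder value. -/
theorem hasDerivAt_Lag {X Xt U : Type*} [Fintype X] [Fintype Xt] [Fintype U]
    [DecidableEq X] [DecidableEq Xt]
    (T : ℕ) (β : ℝ)
    (ptr : ℕ → X → U → X → ℝ) (q : ℕ → X → Xt → ℝ) (pol : ℕ → Xt → U → ℝ)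
    (c : ℕ → X → U → ℝ) (ν : ℕ → X → ℝ) (qbar : ℕ → Xt → ℝ) (pm : ℕ → X → ℝ)
    {t : ℕ} (ht : t < T) (x : X) (xt : Xt) {s : ℝ} (hs : 0 < s) (hqb : 0 < qbar t xt) :
    HasDerivAt
      (fun s => Lag T β ptr
        (fun t' x' xt' => if t' = t ∧ x' = x ∧ xt' = xt then s else q t' x' xt')
        pol c ν qbar pm)
      (pm t x * (EcondXXt (ptr t) (pol t) (c t) (ν (t + 1)) x xt
        + (1 / β) * (Real.log (s / qbar t xt) + 1))) s := by
  simp only [Lag_eq_sum]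
  set D := pm t x * (EcondXXt (ptr t) (pol t) (c t) (ν (t + 1)) x xt
        + (1 / β) * (Real.log (s / qbar t xt) + 1)) with hD
  have hsum : D = ∑ t' ∈ range T, ∑ x', ∑ xt',
      if t' = t ∧ x' = x ∧ xt' = xt then D else 0 := by
    simp [ite_and, ht]
  rw [hsum]
  refine HasDerivAt.sub_const _ (HasDerivAt.fun_sum fun t' _ => HasDerivAt.fun_sum fun x' _ =>
    HasDerivAt.fun_sum fun xt' _ => ?_)
  by_cases h : t' = t ∧ x' = x ∧ xt' = xt
  · obtain ⟨rfl, rfl, rfl⟩ := h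
    simp only [and_self, if_true]
    have hlog : HasDerivAt (fun s => s * Real.log (s / qbar t' xt'))
        (Real.log (s / qbar t' xt') + 1) s := by
      refine ((hasDerivAt_id' s).fun_mul (((hasDerivAt_id' s).div_const (qbar t' xt')).log
        (div_pos hs hqb).ne')).congr_deriv ?_
      field_simp
    refine ((((hasDerivAt_id' s).mul_const _).fun_add
      (hlog.const_mul (1 / β))).const_mul (pm t' x')).congr_deriv ?_
    rw [hD, one_mul]
  · simp only [h, if_false]
    exact hasDerivAt_const _ _

/-- Weights proportional to `w` and summing to one are the normalization of `w`. -/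
theorem eq_div_sum_of_eq_mul {ι : Type*} [Fintype ι] {q w : ι → ℝ} {k : ℝ}
    (h : ∀ i, q i = w i * k) (hq : ∑ i, q i = 1) (i : ι) : q i = w i / ∑ j, w j := by
  have hk : (∑ j, w j) * k = 1 := by rw [sum_mul, ← hq]; exact (sum_congr rfl fun j _ => h j).symm
  rw [h, eq_div_iff (left_ne_zero_of_mul_eq_one hk), mul_assoc, mul_comm k, hk, mul_one]

/-- **The optimal encoder is a Boltzmann distribution (Theorem 2).**
Fix `t < T` and `x` with `p_t(x) > 0`, and suppose `q_t(x̃|x) > 0` and `q̄_t(x̃) > 0` for all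
`x̃`.  If there is a multiplier `λ` such that the partial derivative of the Lagrangian `L`
with respect to each variable `q_t(x̃|x)` equals `λ`, and `∑ x̃, q_t(x̃|x) = 1`, then
`q_t(x̃|x) = q̄_t(x̃) exp(−β E(ν_{t+1} + c_t | x, x̃)) / Z_t(x)` with
`Z_t(x) = ∑ x̃, q̄_t(x̃) exp(−β E(c_t + ν_{t+1} | x, x̃))`. -/
theorem stmt3 {X Xt U : Type*} [Fintype X] [Fintype Xt] [Fintype U]
    [DecidableEq X] [DecidableEq Xt]
    (T : ℕ) (β : ℝ) (hβ : 0 < β)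
    (ptr : ℕ → X → U → X → ℝ) (q : ℕ → X → Xt → ℝ) (pol : ℕ → Xt → U → ℝ)
    (c : ℕ → X → U → ℝ) (cT : X → ℝ) (ν : ℕ → X → ℝ) (qbar : ℕ → Xt → ℝ)
    (pm : ℕ → X → ℝ)
    -- probability-distribution hypotheses from the finite-MDP setting
    (hptr0 : ∀ t x u x', 0 ≤ ptr t x u x') (hptr1 : ∀ t x u, ∑ x', ptr t x u x' = 1)
    (hpol0 : ∀ t xt u, 0 ≤ pol t xt u) (hpol1 : ∀ t xt, ∑ u, pol t xt u = 1)
    (hpm0 : ∀ t x, 0 ≤ pm t x) (hpm1 : ∀ t, ∑ x, pm t x = 1)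
    (hqbar : ∀ t xt, qbar t xt = ∑ x, q t x xt * pm t x)
    (hνT : ν T = cT)
    (t : ℕ) (htT : t < T) (x : X)
    (hpm : 0 < pm t x)
    (hq : ∀ xt, 0 < q t x xt) (hqb : ∀ xt, 0 < qbar t xt)
    (hstat : ∃ lam : ℝ, ∀ xt : Xt,
      deriv
        (fun s => Lag T β ptr
          (fun t' x' xt' => if t' = t ∧ x' = x ∧ xt' = xt then s else q t' x' xt')
          pol c ν qbar pm)
        (q t x xt) = lam)
    (hnorm : ∑ xt, q t x xt = 1) :
    ∀ xt : Xt, q t x xt =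
      qbar t xt * Real.exp (-β * EcondXXt (ptr t) (pol t) (c t) (ν (t + 1)) x xt)
        / (∑ xt', qbar t xt' *
            Real.exp (-β * EcondXXt (ptr t) (pol t) (c t) (ν (t + 1)) x xt')) := by
  obtain ⟨lam, hlam⟩ := hstat
  refine eq_div_sum_of_eq_mul (k := Real.exp (β * lam / pm t x - 1)) (fun xt => ?_) hnorm
  have hd := (hasDerivAt_Lag T β ptr q pol c ν qbar pm htT x xt (hq xt) (hqb xt)).deriv.symm.trans
    (hlam xt)
  have hlog : Real.log (q t x xt / qbar t xt) =
      -β * EcondXXt (ptr t) (pol t) (c t) (ν (t + 1)) x xt + (β * lam / pm t x - 1) := by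
    rw [← hd]
    field_simp
    ring
  rw [mul_assoc, ← Real.exp_add, ← hlog, Real.exp_log (div_pos (hq xt) (hqb xt)),
    mul_div_cancel₀ _ (hqb xt).ne']
end

section
/- Let n, m, k ∈ ℕ and fix A ∈ ℝ^{n×n}, B ∈ ℝ^{n×m}, C ∈ ℝ^{k×n}, K ∈ ℝ^{m×k}, a ∈ ℝ^k, h, w ∈ ℝ^m, g, x̄, b' ∈ ℝ^n, symmetric positive-semidefinite Q ∈ ℝ^{n×n}, R ∈ ℝ^{m×m}, Σ_x, Σ_ε ∈ ℝ^{n×n}, a symmetric P' ∈ ℝ^{n×n}, a symmetric positive-definite Σ_η ∈ ℝ^{k×k}, and β > 0. Set x̄̃ := Cx̄ + a and Σ_x̃ := C Σ_x Cᵀ + Σ_η (positive definite). Define F(x, x̃) := (1/2)(x−g)ᵀQ(x−g) + (1/2)(Kx̃+h−w)ᵀR(Kx̃+h−w) + (1/2)(Ax+B(Kx̃+h))ᵀP'(Ax+B(Kx̃+h)) + b'ᵀ(Ax+B(Kx̃+h)) + (1/2)tr(P'Σ_ε). Suppose Σ_x̃^{-1} + β Kᵀ(BᵀP'B + R)K is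 positive definite. Then the following are equivalent: (i) there exists a function Z : ℝ^n → (0, ∞) such that for all x ∈ ℝ^n and x̃ ∈ ℝ^k, φ(x̃; Cx+a, Σ_η) = φ(x̃; x̄̃, Σ_x̃) · exp( −β F(x, x̃) ) / Z(x); (ii) the three equations hold: Σ_η^{-1} = Σ_x̃^{-1} + β Kᵀ (Bᵀ P' B + R) K, C = −β Σ_η Kᵀ Bᵀ P' A, and a = −Σ_η ( β Kᵀ Bᵀ (b' + P' B h) + β Kᵀ R (h − w) − Σ_x̃^{-1} x̄̃ ). -/
open Matrix MeasureTheory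

/-- Gaussian density on `ℝ^k` with mean `μ` and (positive-definite) covariance `S`:
`φ(z; μ, S) = (2π)^{−k/2} (det S)^{−1/2} exp(−(1/2)(z−μ)ᵀ S⁻¹ (z−μ))`. -/
noncomputable def gauss {k : ℕ} (μ : Fin k → ℝ) (S : Matrix (Fin k) (Fin k) ℝ)
    (z : Fin k → ℝ) : ℝ :=
  (2 * Real.pi) ^ (-(k : ℝ) / 2) * S.det ^ (-(1 : ℝ) / 2) *
    Real.exp (-(1 / 2 : ℝ) * ((z - μ) ⬝ᵥ (S⁻¹ *ᵥ (z - μ))))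

/-- The conditional expected cost-to-go
`F(x,x̃) = (1/2)(x−g)ᵀQ(x−g) + (1/2)(Kx̃+h−w)ᵀR(Kx̃+h−w)
  + (1/2)(Ax+B(Kx̃+h))ᵀP'(Ax+B(Kx̃+h)) + b'ᵀ(Ax+B(Kx̃+h)) + (1/2)tr(P'Σε)`. -/
noncomputable def Fcost {n m k : ℕ}
    (A : Matrix (Fin n) (Fin n) ℝ) (B : Matrix (Fin n) (Fin m) ℝ)
    (K : Matrix (Fin m) (Fin k) ℝ) (h w : Fin m → ℝ) (g b' : Fin n → ℝ)
    (Q P' : Matrix (Fin n) (Fin n) ℝ) (R : Matrix (Fin m) (Fin m) ℝ)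
    (Sε : Matrix (Fin n) (Fin n) ℝ) (x : Fin n → ℝ) (xt : Fin k → ℝ) : ℝ :=
  (1 / 2) * ((x - g) ⬝ᵥ (Q *ᵥ (x - g)))
    + (1 / 2) * ((K *ᵥ xt + h - w) ⬝ᵥ (R *ᵥ (K *ᵥ xt + h - w)))
    + (1 / 2) * ((A *ᵥ x + B *ᵥ (K *ᵥ xt + h)) ⬝ᵥ (P' *ᵥ (A *ᵥ x + B *ᵥ (K *ᵥ xt + h))))
    + b' ⬝ᵥ (A *ᵥ x + B *ᵥ (K *ᵥ xt + h))
    + (1 / 2) * (P' * Sε).trace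

theorem mulVec_dotProduct_eq_dotProduct_transpose_mulVec {ι κ : Type*} [Fintype ι] [Fintype κ]
    (M : Matrix ι κ ℝ) (u : κ → ℝ) (v : ι → ℝ) : (M *ᵥ u) ⬝ᵥ v = u ⬝ᵥ (Mᵀ *ᵥ v) := by
  rw [dotProduct_comm, dotProduct_mulVec, ← mulVec_transpose, dotProduct_comm]

theorem dotProduct_mulVec_add_of_isSymm {ι : Type*} [Fintype ι] {M : Matrix ι ι ℝ}
    (hM : M.IsSymm) (u v : ι → ℝ) :
    (u + v) ⬝ᵥ (M *ᵥ (u + v)) = u ⬝ᵥ (M *ᵥ u) + 2 * (u ⬝ᵥ (M *ᵥ v)) + v ⬝ᵥ (M *ᵥ v) := by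
  have hvu : v ⬝ᵥ (M *ᵥ u) = u ⬝ᵥ (M *ᵥ v) := by
    rw [dotProduct_comm, mulVec_dotProduct_eq_dotProduct_transpose_mulVec, hM.eq]
  rw [mulVec_add, add_dotProduct, dotProduct_add, dotProduct_add, hvu]
  ring

/-- A quadratic polynomial without constant term vanishes identically iff its coefficients do. -/
theorem half_dotProduct_mulVec_add_dotProduct_eq_zero_iff {ι : Type*} [Fintype ι] [DecidableEq ι] {M : Matrix ι ι ℝ}
    (hM : M.IsSymm) (l : ι → ℝ) :
    (∀ z : ι → ℝ, (1 / 2) * (z ⬝ᵥ (M *ᵥ z)) + z ⬝ᵥ l = 0) ↔ M = 0 ∧ l = 0 := by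
  refine ⟨fun hz => ?_, fun ⟨hM0, hl⟩ z => by simp [hM0, hl]⟩
  have hlin : ∀ z : ι → ℝ, z ⬝ᵥ l = 0 := fun z => by
    have hneg := hz (-z)
    simp only [mulVec_neg, neg_dotProduct, dotProduct_neg, neg_neg] at hneg
    linarith [hz z]
  have hquad : ∀ z : ι → ℝ, z ⬝ᵥ (M *ᵥ z) = 0 := fun z => by linarith [hz z, hlin z]
  have hpolar : ∀ u v : ι → ℝ, u ⬝ᵥ (M *ᵥ v) = 0 := fun u v => by
    linarith [dotProduct_mulVec_add_of_isSymm hM u v, hquad (u + v), hquad u, hquad v]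
  refine ⟨Matrix.ext_of_mulVec_single fun i => ?_, dotProduct_self_eq_zero.mp (hlin l)⟩
  rw [zero_mulVec]
  exact dotProduct_self_eq_zero.mp (hpolar _ _)

/-- Two functions `exp ∘ p` and `exp ∘ q` agree up to positive factors independent of the second
argument iff the difference of the exponents does not depend on that argument. -/
theorem exists_pos_normalizer_iff {X ι : Type*} {c d : ℝ} (hc : 0 < c) (hd : 0 < d)
    (p q : X → (ι → ℝ) → ℝ) :
    (∃ Z : X → ℝ, (∀ x, 0 < Z x) ∧ ∀ x z, c * Real.exp (p x z) = d * Real.exp (q x z) / Z x) ↔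
      ∀ x z, q x z - p x z = q x 0 - p x 0 := by
  constructor
  · rintro ⟨Z, hZ, hpq⟩
    have hratio : ∀ x z, Real.exp (q x z - p x z) = c * Z x / d := fun x z => by
      have hxz := hpq x z
      have hZx := (hZ x).ne'
      rw [eq_div_iff hZx] at hxz
      rw [Real.exp_sub, div_eq_div_iff (Real.exp_pos _).ne' hd.ne']
      linarith
    exact fun x z => Real.exp_injective ((hratio x z).trans (hratio x 0).symm)
  · intro hpq
    refine ⟨fun x => d / c * Real.exp (q x 0 - p x 0), fun x => by positivity, fun x z => ?_⟩
    dsimp only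
    rw [← hpq x z, Real.exp_sub]
    field_simp

/-- The Gaussian exponent as a polynomial in the variable. -/
theorem gauss_exponent_expand {ι : Type*} [Fintype ι] {T : Matrix ι ι ℝ} (hT : T.IsSymm)
    (z μ : ι → ℝ) :
    (z - μ) ⬝ᵥ (T *ᵥ (z - μ)) = z ⬝ᵥ (T *ᵥ z) - 2 * (z ⬝ᵥ (T *ᵥ μ)) + μ ⬝ᵥ (T *ᵥ μ) := by
  rw [sub_eq_add_neg, dotProduct_mulVec_add_of_isSymm hT]
  simp only [mulVec_neg, neg_dotProduct, dotProduct_neg, neg_neg]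
  ring

theorem Fcost_expand {n m k : ℕ}
    (A : Matrix (Fin n) (Fin n) ℝ) (B : Matrix (Fin n) (Fin m) ℝ)
    (K : Matrix (Fin m) (Fin k) ℝ) (h w : Fin m → ℝ) (g b' : Fin n → ℝ)
    (Q : Matrix (Fin n) (Fin n) ℝ) {P' : Matrix (Fin n) (Fin n) ℝ} (hP' : P'.IsSymm)
    {R : Matrix (Fin m) (Fin m) ℝ} (hR : R.IsSymm)
    (Sε : Matrix (Fin n) (Fin n) ℝ) (x : Fin n → ℝ) (z : Fin k → ℝ) :
    Fcost A B K h w g b' Q P' R Sε x z = Fcost A B K h w g b' Q P' R Sε x 0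
      + (1 / 2) * (z ⬝ᵥ ((Kᵀ * (Bᵀ * P' * B + R) * K) *ᵥ z))
      + z ⬝ᵥ ((Kᵀ * Bᵀ * P' * A) *ᵥ x + (Kᵀ *ᵥ (Bᵀ *ᵥ (b' + P' *ᵥ (B *ᵥ h)))
          + Kᵀ *ᵥ (R *ᵥ (h - w)))) := by
  have hdyn : A *ᵥ x + B *ᵥ (K *ᵥ z + h) = B *ᵥ (K *ᵥ z) + (A *ᵥ x + B *ᵥ h) := by
    rw [mulVec_add]; abel
  have hb : b' ⬝ᵥ (B *ᵥ (K *ᵥ z)) = z ⬝ᵥ (Kᵀ *ᵥ (Bᵀ *ᵥ b')) := by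
    rw [dotProduct_comm, mulVec_dotProduct_eq_dotProduct_transpose_mulVec,
      mulVec_dotProduct_eq_dotProduct_transpose_mulVec]
  unfold Fcost
  rw [hdyn, add_sub_assoc (K *ᵥ z), dotProduct_mulVec_add_of_isSymm hR,
    dotProduct_mulVec_add_of_isSymm hP', dotProduct_add b', hb]
  simp only [mulVec_zero, zero_add, mulVec_dotProduct_eq_dotProduct_transpose_mulVec K,
    mulVec_dotProduct_eq_dotProduct_transpose_mulVec B, Matrix.mul_add, Matrix.add_mul,
    mulVec_add, add_mulVec, dotProduct_add, ← mulVec_mulVec]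
  ring

/-- **Boltzmann first-order condition ↔ linear-Gaussian necessary conditions (Theorem 3).**
With `x̄̃ := Cx̄ + a`, `Σx̃ := C Σx Cᵀ + Ση`, and `Σx̃⁻¹ + βKᵀ(BᵀP'B+R)K` positive definite,
the Boltzmann condition
`φ(x̃; Cx+a, Ση) = φ(x̃; x̄̃, Σx̃) exp(−β F(x,x̃)) / Z(x)` for some positive `Z`
holds iff the three equations
`Ση⁻¹ = Σx̃⁻¹ + βKᵀ(BᵀP'B+R)K`, `C = −β Ση Kᵀ Bᵀ P' A`, and
`a = −Ση(βKᵀBᵀ(b'+P'Bh) + βKᵀR(h−w) − Σx̃⁻¹x̄̃)` hold. -/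
theorem stmt9 {n m k : ℕ}
    (A : Matrix (Fin n) (Fin n) ℝ) (B : Matrix (Fin n) (Fin m) ℝ)
    (C : Matrix (Fin k) (Fin n) ℝ) (K : Matrix (Fin m) (Fin k) ℝ)
    (a : Fin k → ℝ) (h w : Fin m → ℝ) (g xb b' : Fin n → ℝ)
    (Q : Matrix (Fin n) (Fin n) ℝ) (hQ : Q.PosSemidef)
    (R : Matrix (Fin m) (Fin m) ℝ) (hR : R.PosSemidef)
    (Sx Sε : Matrix (Fin n) (Fin n) ℝ) (hSx : Sx.PosSemidef) (hSε : Sε.PosSemidef)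
    (P' : Matrix (Fin n) (Fin n) ℝ) (hP' : P'.IsSymm)
    (Sη : Matrix (Fin k) (Fin k) ℝ) (hSη : Sη.PosDef)
    (β : ℝ) (hβ : 0 < β)
    (hpd : ((C * Sx * Cᵀ + Sη)⁻¹ + β • (Kᵀ * (Bᵀ * P' * B + R) * K)).PosDef) :
    ((∃ Z : (Fin n → ℝ) → ℝ, (∀ x, 0 < Z x) ∧
        ∀ (x : Fin n → ℝ) (xt : Fin k → ℝ),
          gauss (C *ᵥ x + a) Sη xt =
            gauss (C *ᵥ xb + a) (C * Sx * Cᵀ + Sη) xt *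
              Real.exp (-β * Fcost A B K h w g b' Q P' R Sε x xt) / Z x)
      ↔ (Sη⁻¹ = (C * Sx * Cᵀ + Sη)⁻¹ + β • (Kᵀ * (Bᵀ * P' * B + R) * K)
          ∧ C = -(β • (Sη * Kᵀ * Bᵀ * P' * A))
          ∧ a = -(Sη *ᵥ (β • (Kᵀ *ᵥ (Bᵀ *ᵥ (b' + P' *ᵥ (B *ᵥ h))))
              + β • (Kᵀ *ᵥ (R *ᵥ (h - w)))
              - (C * Sx * Cᵀ + Sη)⁻¹ *ᵥ (C *ᵥ xb + a))))) := by
  have hS : (C * Sx * Cᵀ + Sη).PosDef := by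
    have hCS := hSx.mul_mul_conjTranspose_same C
    rw [conjTranspose_eq_transpose_of_trivial] at hCS
    exact PosDef.posSemidef_add hCS hSη
  have hRs : R.IsSymm := by simpa using hR.isHermitian
  have hE : (Sη⁻¹).IsSymm := by simpa using hSη.inv.isHermitian
  generalize C * Sx * Cᵀ + Sη = S at hS hpd ⊢
  have hT : (S⁻¹).IsSymm := by simpa using hS.inv.isHermitian
  have hG : (S⁻¹ + β • (Kᵀ * (Bᵀ * P' * B + R) * K)).IsSymm := by simpa using hpd.isHermitian
  have hunit : IsUnit Sη.det := hSη.det_pos.ne'.isUnit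
  set G := Kᵀ * (Bᵀ * P' * B + R) * K with hGdef
  set r := Kᵀ *ᵥ (Bᵀ *ᵥ (b' + P' *ᵥ (B *ᵥ h))) with hr
  set s := Kᵀ *ᵥ (R *ᵥ (h - w)) with hs
  set W := Sη⁻¹ - (S⁻¹ + β • G) with hW
  set N := Sη⁻¹ * C + β • (Kᵀ * Bᵀ * P' * A) with hN
  set l := Sη⁻¹ *ᵥ a + (β • r + β • s - S⁻¹ *ᵥ (C *ᵥ xb + a)) with hl
  have hWs : W.IsSymm := hE.sub hG
  have hexp : ∀ (x : Fin n → ℝ) (z : Fin k → ℝ),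
      (-(1 / 2 : ℝ) * ((z - (C *ᵥ xb + a)) ⬝ᵥ (S⁻¹ *ᵥ (z - (C *ᵥ xb + a))))
          + -β * Fcost A B K h w g b' Q P' R Sε x z)
        - -(1 / 2 : ℝ) * ((z - (C *ᵥ x + a)) ⬝ᵥ (Sη⁻¹ *ᵥ (z - (C *ᵥ x + a))))
      = (-(1 / 2 : ℝ) * ((0 - (C *ᵥ xb + a)) ⬝ᵥ (S⁻¹ *ᵥ (0 - (C *ᵥ xb + a))))
          + -β * Fcost A B K h w g b' Q P' R Sε x 0)
        - -(1 / 2 : ℝ) * ((0 - (C *ᵥ x + a)) ⬝ᵥ (Sη⁻¹ *ᵥ (0 - (C *ᵥ x + a))))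
      + ((1 / 2) * (z ⬝ᵥ (W *ᵥ z)) + z ⬝ᵥ (-(N *ᵥ x + l))) := fun x z => by
    rw [Fcost_expand A B K h w g b' Q hP' hRs Sε x z, ← hGdef, ← hr, ← hs,
      gauss_exponent_expand hT z, gauss_exponent_expand hE z,
      gauss_exponent_expand hT 0, gauss_exponent_expand hE 0, hW, hN, hl]
    simp only [mulVec_add, add_mulVec, sub_mulVec, smul_mulVec, dotProduct_add, dotProduct_sub,
      dotProduct_neg, dotProduct_smul, zero_dotProduct, smul_eq_mul, ← mulVec_mulVec]
    ring
  have hnorm : ∀ {M : Matrix (Fin k) (Fin k) ℝ}, M.PosDef →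
      0 < (2 * Real.pi) ^ (-(k : ℝ) / 2) * M.det ^ (-(1 : ℝ) / 2) := fun hM =>
    mul_pos (Real.rpow_pos_of_pos (by positivity) _) (Real.rpow_pos_of_pos hM.det_pos _)
  have hC : N = 0 ↔ C = -(β • (Sη * Kᵀ * Bᵀ * P' * A)) := by
    constructor
    · intro hN0
      have hmul := congrArg (Sη * ·) hN0
      simp only [hN, Matrix.mul_add, mul_nonsing_inv_cancel_left _ _ hunit, Matrix.mul_zero,
        Matrix.mul_smul] at hmul
      simpa only [Matrix.mul_assoc] using eq_neg_of_add_eq_zero_left hmul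
    · intro hCeq
      rw [hN]
      nth_rw 1 [hCeq]
      simp only [Matrix.mul_neg, Matrix.mul_smul, Matrix.mul_assoc,
        nonsing_inv_mul_cancel_left _ _ hunit, neg_add_cancel]
  have ha : l = 0 ↔ a = -(Sη *ᵥ (β • r + β • s - S⁻¹ *ᵥ (C *ᵥ xb + a))) := by
    generalize β • r + β • s - S⁻¹ *ᵥ (C *ᵥ xb + a) = t at hl
    rw [hl]
    constructor
    · intro hl0
      have hmul := congrArg (Sη *ᵥ ·) hl0
      simp only [mulVec_add, mulVec_mulVec, mul_nonsing_inv _ hunit, one_mulVec,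
        mulVec_zero] at hmul
      exact eq_neg_of_add_eq_zero_left hmul
    · intro haeq
      rw [haeq, mulVec_neg, mulVec_mulVec, nonsing_inv_mul _ hunit, one_mulVec, neg_add_cancel]
  have haffine : (∀ x, -(N *ᵥ x + l) = 0) ↔ N = 0 ∧ l = 0 := by
    refine ⟨fun hx => ?_, fun ⟨hN0, hl0⟩ x => by simp [hN0, hl0]⟩
    have hl0 : l = 0 := by simpa using hx 0
    refine ⟨Matrix.ext_of_mulVec_single fun i => ?_, hl0⟩
    simpa only [hl0, add_zero, neg_eq_zero, zero_mulVec] using hx (Pi.single i 1)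
  simp only [gauss, mul_assoc _ (Real.exp _) (Real.exp _), ← Real.exp_add]
  rw [exists_pos_normalizer_iff (hnorm hSη) (hnorm hS)]
  rw [← hC, ← ha, ← haffine, ← sub_eq_zero, ← hW,
    ← forall_const (b := W = 0) (Fin n → ℝ), ← forall_and]
  refine forall_congr' fun x => ?_
  rw [← half_dotProduct_mulVec_add_dotProduct_eq_zero_iff hWs]
  refine forall_congr' fun z => ?_
  rw [hexp, add_eq_left]
end

section
/- Let n, m, k, k' ∈ ℕ, x̄ ∈ ℝ^n, a ∈ ℝ^k, a' ∈ ℝ^{k'}, C ∈ ℝ^{k×n}, C' ∈ ℝ^{k'×n}, A ∈ ℝ^{n×n}, B ∈ ℝ^{n×m}, with Σ_x, Σ_ε ∈ ℝ^{n×n}, Σ_η ∈ ℝ^{k×k}, Σ_{η'} ∈ ℝ^{k'×k'} symmetric positive definite. Set x̄̃ := Cx̄ + a, Σ_x̃ := C Σ_x Cᵀ + Σ_η, μ(x̃) := x̄ + Σ_x Cᵀ Σ_x̃^{-1} (x̃ − x̄̃), Σ_{x|x̃} := Σ_x − Σ_x Cᵀ Σ_x̃^{-1} C Σ_x, Ã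 := C' A Σ_x Cᵀ Σ_x̃^{-1}, B̃ := C' B, and r̃ := −Ã x̄̃ + C' A x̄ + a'. Then for all x̃ ∈ ℝ^k, u ∈ ℝ^m, and x̃' ∈ ℝ^{k'}: ∫_{ℝ^n} ∫_{ℝ^n} φ(x; μ(x̃), Σ_{x|x̃}) · φ(x'; Ax + Bu, Σ_ε) · φ(x̃'; C'x' + a', Σ_{η'}) dx' dx = φ( x̃'; Ã x̃ + B̃ u + r̃, C' ( A Σ_{x|x̃} Aᵀ + Σ_ε ) C'ᵀ + Σ_{η'} ); i.e., the conditional distribution of the next task-relevant variable x̃' given the current one x̃ and the input u is Gaussian with mean affine in (x̃, u) given by the induced linear-Gaussian system (Ã, B̃, r̃) and the stated covariance. -/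
open Matrix MeasureTheory

open scoped MatrixOrder Matrix.Norms.L2Operator in
theorem Matrix.PosDef.exists_eq_transpose_mul_self {ι : Type*} [Fintype ι] [DecidableEq ι]
    {S : Matrix ι ι ℝ} (hS : S.PosDef) : ∃ L : Matrix ι ι ℝ, L.det ≠ 0 ∧ S = Lᵀ * L := by
  obtain ⟨L, hL, h⟩ :=
    CStarAlgebra.isStrictlyPositive_iff_eq_star_mul_self.mp hS.isStrictlyPositive
  exact ⟨L, ((Matrix.isUnit_iff_isUnit_det L).mp hL).ne_zero, by
    rw [h, star_eq_conjTranspose, conjTranspose_eq_transpose_of_trivial]⟩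

theorem integral_comp_mulVec {ι E : Type*} [Fintype ι] [DecidableEq ι] [NormedAddCommGroup E]
    [NormedSpace ℝ E] {L : Matrix ι ι ℝ} (hL : L.det ≠ 0) (f : (ι → ℝ) → E) :
    ∫ x, f (L *ᵥ x) = |L.det⁻¹| • ∫ x, f x := by
  have hinj : Function.Injective (toLin' L) :=
    Matrix.mulVec_injective_of_isUnit ((Matrix.isUnit_iff_isUnit_det L).mpr hL.isUnit)
  have he : MeasurableEmbedding (toLin' L) :=
    ((toLin' L).continuous_of_finiteDimensional).measurableEmbedding hinj
  have h := he.integral_map (μ := volume) f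
  rw [Real.map_matrix_volume_pi_eq_smul_volume_pi hL, integral_smul_measure,
    ENNReal.toReal_ofReal (abs_nonneg _)] at h
  simpa using h.symm

theorem integral_exp_neg_half_dotProduct_self (n : ℕ) :
    ∫ x : Fin n → ℝ, Real.exp (-(1 / 2 : ℝ) * (x ⬝ᵥ x)) = (2 * Real.pi) ^ ((n : ℝ) / 2) := by
  have h : ∀ x : Fin n → ℝ, Real.exp (-(1 / 2 : ℝ) * (x ⬝ᵥ x))
      = ∏ i, Real.exp (-(1 / 2 : ℝ) * x i ^ 2) := fun x => by
    rw [← Real.exp_sum, ← Finset.mul_sum, dotProduct]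
    simp only [sq]
  simp_rw [h]
  rw [integral_fintype_prod_volume_eq_pow (fun t : ℝ => Real.exp (-(1 / 2 : ℝ) * t ^ 2)),
    integral_gaussian, Fintype.card_fin, Real.sqrt_eq_rpow, ← Real.rpow_mul_natCast (by positivity)]
  congr 1 <;> ring

theorem integral_gauss {n : ℕ} (μ : Fin n → ℝ) {S : Matrix (Fin n) (Fin n) ℝ} (hS : S.PosDef) :
    ∫ x, gauss μ S x = 1 := by
  obtain ⟨L, hL, h⟩ := hS.inv.exists_eq_transpose_mul_self
  have hdet : S.det ^ (-(1 : ℝ) / 2) = |L.det| := by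
    have h2 : S.det⁻¹ = |L.det| ^ 2 := by
      rw [sq_abs, ← Ring.inverse_eq_inv', ← det_nonsing_inv, h, det_mul, det_transpose, sq]
    rw [neg_div, Real.rpow_neg hS.det_pos.le, ← Real.inv_rpow hS.det_pos.le, h2,
      ← Real.sqrt_eq_rpow, Real.sqrt_sq (abs_nonneg _)]
  have hquad : ∀ v : Fin n → ℝ, v ⬝ᵥ (S⁻¹ *ᵥ v) = (L *ᵥ v) ⬝ᵥ (L *ᵥ v) := fun v => by
    rw [h, ← mulVec_mulVec, dotProduct_mulVec, vecMul_transpose]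
  simp only [gauss, integral_const_mul, hquad, hdet]
  rw [integral_sub_right_eq_self
      (fun x => Real.exp (-(1 / 2 : ℝ) * ((L *ᵥ x) ⬝ᵥ (L *ᵥ x)))) μ,
    integral_comp_mulVec hL (fun x => Real.exp (-(1 / 2 : ℝ) * (x ⬝ᵥ x))),
    integral_exp_neg_half_dotProduct_self, smul_eq_mul, abs_inv, neg_div,
    Real.rpow_neg (by positivity)]
  have := abs_pos.mpr hL
  field_simp

section Conditioning

variable {n k : ℕ} {S : Matrix (Fin n) (Fin n) ℝ} {R : Matrix (Fin k) (Fin k) ℝ}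

theorem posDef_mul_mul_transpose_add (hS : S.PosDef) (hR : R.PosDef)
    (M : Matrix (Fin k) (Fin n) ℝ) : (M * S * Mᵀ + R).PosDef := by
  have := hS.posSemidef.mul_mul_conjTranspose_same M
  rw [conjTranspose_eq_transpose_of_trivial] at this
  exact hR.posSemidef_add this

theorem posDef_precision (hS : S.PosDef) (hR : R.PosDef) (M : Matrix (Fin k) (Fin n) ℝ) :
    (S⁻¹ + Mᵀ * R⁻¹ * M).PosDef := by
  have := hR.inv.posSemidef.conjTranspose_mul_mul_same M
  rw [conjTranspose_eq_transpose_of_trivial] at this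
  exact hS.inv.add_posSemidef this

theorem inv_precision (hS : S.PosDef) (hR : R.PosDef) (M : Matrix (Fin k) (Fin n) ℝ) :
    (S⁻¹ + Mᵀ * R⁻¹ * M)⁻¹ = S - S * Mᵀ * (M * S * Mᵀ + R)⁻¹ * M * S := by
  have hS' := (Matrix.isUnit_iff_isUnit_det S).mp hS.isUnit
  have hR' := (Matrix.isUnit_iff_isUnit_det R).mp hR.isUnit
  have hT := (posDef_mul_mul_transpose_add hS hR M).isUnit
  rw [add_comm] at hT
  rw [add_mul_mul_inv_eq_sub _ _ _ _ hS.inv.isUnit hR.inv.isUnit,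
    nonsing_inv_nonsing_inv _ hS', nonsing_inv_nonsing_inv _ hR', add_comm R]
  rwa [nonsing_inv_nonsing_inv _ hS', nonsing_inv_nonsing_inv _ hR']

theorem posDef_conditional (hS : S.PosDef) (hR : R.PosDef) (M : Matrix (Fin k) (Fin n) ℝ) :
    (S - S * Mᵀ * (M * S * Mᵀ + R)⁻¹ * M * S).PosDef :=
  inv_precision hS hR M ▸ (posDef_precision hS hR M).inv

theorem det_mul_mul_transpose_add (hS : S.PosDef) (hR : R.PosDef) (M : Matrix (Fin k) (Fin n) ℝ) :
    (M * S * Mᵀ + R).det = S.det * R.det * (S⁻¹ + Mᵀ * R⁻¹ * M).det := by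
  have hS' := (Matrix.isUnit_iff_isUnit_det S).mp hS.isUnit
  have hR' := (Matrix.isUnit_iff_isUnit_det R).mp hR.isUnit
  rw [add_comm, Matrix.mul_assoc, det_add_mul M (S * Mᵀ) hR', mul_comm S.det, mul_assoc, ← det_mul,
    Matrix.mul_add, mul_nonsing_inv _ hS']
  simp only [Matrix.mul_assoc]

/-- Completing the square in the joint exponent of `v` and `w`. -/
theorem quadratic_complete_square (hS : S.PosDef) (hR : R.PosDef) (M : Matrix (Fin k) (Fin n) ℝ)
    (v : Fin n → ℝ) (w : Fin k → ℝ) :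
    v ⬝ᵥ (S⁻¹ *ᵥ v) + (w - M *ᵥ v) ⬝ᵥ (R⁻¹ *ᵥ (w - M *ᵥ v))
      = w ⬝ᵥ ((M * S * Mᵀ + R)⁻¹ *ᵥ w)
        + (v - (S * Mᵀ * (M * S * Mᵀ + R)⁻¹) *ᵥ w) ⬝ᵥ
          ((S⁻¹ + Mᵀ * R⁻¹ * M) *ᵥ (v - (S * Mᵀ * (M * S * Mᵀ + R)⁻¹) *ᵥ w)) := by
  have hS' := (Matrix.isUnit_iff_isUnit_det S).mp hS.isUnit
  have hR' := (Matrix.isUnit_iff_isUnit_det R).mp hR.isUnit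
  have hTpos := posDef_mul_mul_transpose_add hS hR M
  have hQpos := posDef_precision hS hR M
  set T := M * S * Mᵀ + R with hT
  set Q := S⁻¹ + Mᵀ * R⁻¹ * M with hQ
  set K := S * Mᵀ * T⁻¹ with hK
  have hT' := (Matrix.isUnit_iff_isUnit_det T).mp hTpos.isUnit
  have symm : ∀ {l : ℕ} {P : Matrix (Fin l) (Fin l) ℝ}, P.PosDef → Pᵀ = P := fun h => by
    simpa [conjTranspose_eq_transpose_of_trivial] using h.isHermitian.eq
  have hQK : Q * K = Mᵀ * R⁻¹ := by
    have : Q * (S * Mᵀ) = Mᵀ * R⁻¹ * T := by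
      rw [hQ, hT, Matrix.add_mul, Matrix.mul_add, nonsing_inv_mul_cancel_left _ _ hS',
        nonsing_inv_mul_cancel_right _ _ hR', add_comm]
      simp only [Matrix.mul_assoc]
    rw [hK, ← Matrix.mul_assoc, this, mul_nonsing_inv_cancel_right _ _ hT']
  have hKQK : Kᵀ * (Q * K) = R⁻¹ - T⁻¹ := by
    have hMS : M * S * Mᵀ = T - R := by rw [hT, add_sub_cancel_right]
    rw [hQK, hK, transpose_mul, transpose_mul, transpose_transpose, symm hS, symm hTpos.inv,
      Matrix.mul_assoc, ← Matrix.mul_assoc (M * S), hMS, Matrix.sub_mul, Matrix.mul_sub,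
      mul_nonsing_inv _ hR', nonsing_inv_mul_cancel_left _ _ hT', Matrix.mul_one]
  have hvKw : v ⬝ᵥ (Q *ᵥ (K *ᵥ w)) = (M *ᵥ v) ⬝ᵥ (R⁻¹ *ᵥ w) := by
    rw [mulVec_mulVec, hQK, ← mulVec_mulVec, dotProduct_mulVec, vecMul_transpose]
  have hKwv : (K *ᵥ w) ⬝ᵥ (Q *ᵥ v) = (M *ᵥ v) ⬝ᵥ (R⁻¹ *ᵥ w) := by
    rw [dotProduct_mulVec, ← mulVec_transpose, symm hQpos, dotProduct_comm, hvKw]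
  have hKwKw : (K *ᵥ w) ⬝ᵥ (Q *ᵥ (K *ᵥ w)) = w ⬝ᵥ (R⁻¹ *ᵥ w) - w ⬝ᵥ (T⁻¹ *ᵥ w) := by
    rw [← dotProduct_sub, ← sub_mulVec, ← hKQK, ← mulVec_mulVec w Kᵀ (Q * K),
      dotProduct_mulVec w, vecMul_transpose, mulVec_mulVec w Q K]
  have hvv : v ⬝ᵥ (Q *ᵥ v) = v ⬝ᵥ (S⁻¹ *ᵥ v) + (M *ᵥ v) ⬝ᵥ (R⁻¹ *ᵥ (M *ᵥ v)) := by
    rw [hQ, add_mulVec, dotProduct_add, ← mulVec_mulVec, ← mulVec_mulVec,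
      dotProduct_mulVec v Mᵀ, vecMul_transpose]
  have hwMv : w ⬝ᵥ (R⁻¹ *ᵥ (M *ᵥ v)) = (M *ᵥ v) ⬝ᵥ (R⁻¹ *ᵥ w) := by
    rw [dotProduct_mulVec, ← mulVec_transpose, symm hR.inv, dotProduct_comm]
  simp only [mulVec_sub, dotProduct_sub, sub_dotProduct, hvKw, hKwv, hKwKw, hvv, hwMv]
  ring

/-- Bayes' rule for a Gaussian prior and a linear-Gaussian observation. -/
theorem gauss_mul_gauss (hS : S.PosDef) (hR : R.PosDef) (M : Matrix (Fin k) (Fin n) ℝ)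
    (μ : Fin n → ℝ) (b : Fin k → ℝ) (x : Fin n → ℝ) (y : Fin k → ℝ) :
    gauss μ S x * gauss (M *ᵥ x + b) R y
      = gauss (M *ᵥ μ + b) (M * S * Mᵀ + R) y *
        gauss (μ + (S * Mᵀ * (M * S * Mᵀ + R)⁻¹) *ᵥ (y - (M *ᵥ μ + b)))
          (S - S * Mᵀ * (M * S * Mᵀ + R)⁻¹ * M * S) x := by
  have hQpos := posDef_precision hS hR M
  have hy : y - (M *ᵥ x + b) = (y - (M *ᵥ μ + b)) - M *ᵥ (x - μ) := by
    rw [mulVec_sub]; abel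
  have hdet : S.det ^ (-(1 : ℝ) / 2) * R.det ^ (-(1 : ℝ) / 2)
      = (M * S * Mᵀ + R).det ^ (-(1 : ℝ) / 2) *
        (S⁻¹ + Mᵀ * R⁻¹ * M)⁻¹.det ^ (-(1 : ℝ) / 2) := by
    rw [← Real.mul_rpow hS.det_pos.le hR.det_pos.le,
      ← Real.mul_rpow (posDef_mul_mul_transpose_add hS hR M).det_pos.le hQpos.inv.det_pos.le,
      det_mul_mul_transpose_add hS hR, det_nonsing_inv, Ring.inverse_eq_inv',
      mul_inv_cancel_right₀ hQpos.det_pos.ne']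
  have hexp := congrArg (fun t => Real.exp (-(1 / 2 : ℝ) * t))
    (quadratic_complete_square hS hR M (x - μ) (y - (M *ᵥ μ + b)))
  simp only [mul_add, Real.exp_add] at hexp
  rw [← inv_precision hS hR M]
  simp only [gauss]
  rw [nonsing_inv_nonsing_inv _ ((Matrix.isUnit_iff_isUnit_det _).mp hQpos.isUnit), hy,
    ← sub_sub x μ]
  linear_combination (2 * Real.pi) ^ (-(n : ℝ) / 2) * (2 * Real.pi) ^ (-(k : ℝ) / 2) *
    (S.det ^ (-(1 : ℝ) / 2) * R.det ^ (-(1 : ℝ) / 2) * hexp + hdet *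
      (Real.exp (-(1 / 2 : ℝ) * ((y - (M *ᵥ μ + b)) ⬝ᵥ ((M * S * Mᵀ + R)⁻¹ *ᵥ (y - (M *ᵥ μ + b)))))
      * Real.exp (-(1 / 2 : ℝ) *
        ((x - μ - (S * Mᵀ * (M * S * Mᵀ + R)⁻¹) *ᵥ (y - (M *ᵥ μ + b))) ⬝ᵥ
          ((S⁻¹ + Mᵀ * R⁻¹ * M) *ᵥ
            (x - μ - (S * Mᵀ * (M * S * Mᵀ + R)⁻¹) *ᵥ (y - (M *ᵥ μ + b))))))))

/-- Marginalizing a Gaussian through a linear-Gaussian channel. -/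
theorem integral_gauss_mul_gauss (hS : S.PosDef) (hR : R.PosDef) (M : Matrix (Fin k) (Fin n) ℝ)
    (μ : Fin n → ℝ) (b : Fin k → ℝ) (y : Fin k → ℝ) :
    ∫ x, gauss μ S x * gauss (M *ᵥ x + b) R y = gauss (M *ᵥ μ + b) (M * S * Mᵀ + R) y := by
  simp_rw [gauss_mul_gauss hS hR M μ b _ y]
  rw [integral_const_mul, integral_gauss _ (posDef_conditional hS hR M), mul_one]

end Conditioning

/-- **Induced process model on the task-relevant variables.**
With `x̄̃ := Cx̄ + a`, `Σx̃ := C Σx Cᵀ + Ση`, `μ(x̃) := x̄ + Σx Cᵀ Σx̃⁻¹ (x̃ − x̄̃)`,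
`Σ_{x|x̃} := Σx − Σx Cᵀ Σx̃⁻¹ C Σx`, `Ã := C' A Σx Cᵀ Σx̃⁻¹`, `B̃ := C' B`, and
`r̃ := −Ã x̄̃ + C' A x̄ + a'`, for all `x̃`, `u`, `x̃'`:
`∫∫ φ(x; μ(x̃), Σ_{x|x̃}) φ(x'; Ax+Bu, Σε) φ(x̃'; C'x'+a', Ση') dx' dx
  = φ(x̃'; Ãx̃ + B̃u + r̃, C'(A Σ_{x|x̃} Aᵀ + Σε)C'ᵀ + Ση')`. -/
theorem stmt12 {n m k k' : ℕ} (xb : Fin n → ℝ) (a : Fin k → ℝ) (a' : Fin k' → ℝ)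
    (C : Matrix (Fin k) (Fin n) ℝ) (C' : Matrix (Fin k') (Fin n) ℝ)
    (A : Matrix (Fin n) (Fin n) ℝ) (B : Matrix (Fin n) (Fin m) ℝ)
    (Sx Sε : Matrix (Fin n) (Fin n) ℝ) (hSx : Sx.PosDef) (hSε : Sε.PosDef)
    (Sη : Matrix (Fin k) (Fin k) ℝ) (hSη : Sη.PosDef)
    (Sη' : Matrix (Fin k') (Fin k') ℝ) (hSη' : Sη'.PosDef) :
    let xtb := C *ᵥ xb + a
    let Sxt := C * Sx * Cᵀ + Sη
    let Scond := Sx - Sx * Cᵀ * Sxt⁻¹ * C * Sx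
    let μ : (Fin k → ℝ) → (Fin n → ℝ) :=
      fun xt => xb + Sx *ᵥ (Cᵀ *ᵥ (Sxt⁻¹ *ᵥ (xt - xtb)))
    let At := C' * A * Sx * Cᵀ * Sxt⁻¹
    let Bt := C' * B
    let rt := -(At *ᵥ xtb) + C' *ᵥ (A *ᵥ xb) + a'
    ∀ (xt : Fin k → ℝ) (u : Fin m → ℝ) (xt' : Fin k' → ℝ),
      (∫ x : Fin n → ℝ, ∫ x' : Fin n → ℝ,
          gauss (μ xt) Scond x * gauss (A *ᵥ x + B *ᵥ u) Sε x' *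
            gauss (C' *ᵥ x' + a') Sη' xt')
        = gauss (At *ᵥ xt + Bt *ᵥ u + rt)
            (C' * (A * Scond * Aᵀ + Sε) * C'ᵀ + Sη') xt' := by
  intro xtb Sxt Scond μ At Bt rt xt u xt'
  have hScond : Scond.PosDef := posDef_conditional hSx hSη C
  have hinner : ∀ x : Fin n → ℝ,
      ∫ x' : Fin n → ℝ, gauss (μ xt) Scond x * gauss (A *ᵥ x + B *ᵥ u) Sε x' *
          gauss (C' *ᵥ x' + a') Sη' xt'
        = gauss (μ xt) Scond x *
          gauss ((C' * A) *ᵥ x + (C' *ᵥ (B *ᵥ u) + a')) (C' * Sε * C'ᵀ + Sη') xt' := fun x => by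
    simp_rw [mul_assoc]
    rw [integral_const_mul, integral_gauss_mul_gauss hSε hSη' C', mulVec_add, mulVec_mulVec x,
      add_assoc]
  simp_rw [hinner]
  rw [integral_gauss_mul_gauss hScond (posDef_mul_mul_transpose_add hSε hSη' C')]
  congr 1
  · simp only [μ, At, Bt, rt, mulVec_add, mulVec_sub, ← mulVec_mulVec]
    abel
  · simp only [transpose_mul, Matrix.mul_add, Matrix.add_mul, Matrix.mul_assoc, add_assoc]
end
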